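/- Min property of avalanche correlations: in the stationary process of the DSS, for all sites x, x' ∈ {1,…,L}, every t ≥ 1 and every τ ≥ 1, E[s(x,t) s(x',t+τ)] = E[s(l,t) s(l,t+τ)], where l = min(x, x'). -/

import Mathlib

namespace DSS

/-- A state of the DSS on `L` sites: a stable field `z : Fin L → Bool` together with a
finite multiset `w` of waiting particles (particles past site `L` have left the system). -/
structure State (L : ℕ) where
  z : Fin L → Bool
  w : Multiset (Fin L)

variable {L : ℕ}

/-- The multiset holding the right neighbour of `x`; empty if the particle leaves the system. -/
def succSite (L : ℕ) (x : Fin L) : Multiset (Fin L) :=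
  if h : x.val + 1 < L then {(⟨x.val + 1, h⟩ : Fin L)} else 0

/-- Evolution of a waiting particle at `x` when `z x = 1`: the waiting particle moves to
`x+1` and the stable particle at `x` becomes a waiting particle at `x`. -/
def topple (s : State L) (x : Fin L) : State L :=
  ⟨Function.update s.z x false, s.w + succSite L x⟩

/-- Evolution of a waiting particle at `x` when `z x = 0`, settling branch (probability p). -/
def settle (s : State L) (x : Fin L) : State L :=
  ⟨Function.update s.z x true, s.w.erase x⟩

/-- Evolution of a waiting particle at `x` when `z x = 0`, jumping branch (probability q). -/
def jump (s : State L) (x : Fin L) : State L :=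
  ⟨s.z, s.w.erase x + succSite L x⟩

/-- `stabilizeAux p q R n s c` is the probability that, evolving one waiting particle at a
time (the particle being selected by the rule `R`), the process started from `s` reaches
within `n` elementary steps a stable state whose stable field is `c`. -/
noncomputable def stabilizeAux (p q : ℝ) (R : State L → Option (Fin L)) :
    ℕ → State L → (Fin L → Bool) → ℝ
  | 0, s, c => if s.w = 0 ∧ s.z = c then 1 else 0
  | n + 1, s, c =>
    match R s with
    | none => if s.z = c then 1 else 0
    | some x =>
      if s.z x then stabilizeAux p q R n (topple s x) c
      else p * stabilizeAux p q R n (settle s x) c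
        + q * stabilizeAux p q R n (jump s x) c

/-- The canonical evolution rule: evolve the leftmost waiting particle. -/
def minRule (s : State L) : Option (Fin L) :=
  if h : s.w = 0 then none
  else some (s.w.toFinset.min'
    (Finset.nonempty_iff_ne_empty.mpr (by simpa [Multiset.toFinset_eq_empty] using h)))

/-- A termination measure: the stabilization process started from `s` ends after at most
`fuel s` elementary steps, whatever the rule and the randomness. -/
def potential (s : State L) : ℕ :=
  (s.w.map fun x => L + 1 - x.val).sum + ∑ x : Fin L, (if s.z x then L + 1 - x.val else 0)

def fuel (s : State L) : ℕ := 2 * potential s + Multiset.card s.w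

/-- Add one waiting particle at site `1` (index `0`). -/
def addGrain (r : Fin L → Bool) : State L :=
  ⟨r, if h : 0 < L then {(⟨0, h⟩ : Fin L)} else 0⟩

/-- The driven-dissipative transition kernel `W` of the DSS: add a particle at site 1 and
stabilize. -/
noncomputable def Wker (p q : ℝ) (r r' : Fin L → Bool) : ℝ :=
  stabilizeAux p q minRule (fuel (addGrain r)) (addGrain r) r'

/-- `W` as a matrix on stable configurations. -/
noncomputable def Wmat (p q : ℝ) (L : ℕ) :
    Matrix (Fin L → Bool) (Fin L → Bool) ℝ :=
  Matrix.of fun r r' => Wker p q r r'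

/-- The product Bernoulli(p) measure `ψ(r) = p^(Σ r) q^(L - Σ r)`. -/
noncomputable def psi (p q : ℝ) {L : ℕ} (r : Fin L → Bool) : ℝ :=
  p ^ (Finset.univ.filter fun x => r x = true).card *
    q ^ (L - (Finset.univ.filter fun x => r x = true).card)



/-- Same as `stabilizeAux`, additionally recording the number of topplings performed at each
site: `stabilizeSAux p q R n s c k` is the probability that the process started from `s`
terminates within `n` steps on the stable field `c` having performed exactly `k x`
topplings (transfers of a waiting particle from `x` to `x+1`) at each site `x`. -/
noncomputable def stabilizeSAux (p q : ℝ) (R : State L → Option (Fin L)) :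
    ℕ → State L → (Fin L → Bool) → (Fin L → ℕ) → ℝ
  | 0, s, c, k => if s.w = 0 ∧ s.z = c ∧ k = 0 then 1 else 0
  | n + 1, s, c, k =>
    match R s with
    | none => if s.z = c ∧ k = 0 then 1 else 0
    | some x =>
      if s.z x then
        (if k x = 0 then 0
          else stabilizeSAux p q R n (topple s x) c (Function.update k x (k x - 1)))
      else
        p * stabilizeSAux p q R n (settle s x) c k
          + q * (if k x = 0 then 0
              else stabilizeSAux p q R n (jump s x) c (Function.update k x (k x - 1)))

/-- Joint avalanche kernel: `Kker p q r r' k` is the probability that, adding one particle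
at site 1 to the stable configuration `r`, the resulting avalanche leads to the stable
configuration `r'` with exactly `k x` topplings at each site `x`. -/
noncomputable def Kker (p q : ℝ) (r r' : Fin L → Bool) (k : Fin L → ℕ) : ℝ :=
  stabilizeSAux p q minRule (fuel (addGrain r)) (addGrain r) r' k

/-- `E[s(x,t)]`: expectation of the number of topplings at site `x` in the `t`-th avalanche
(`t ≥ 1`), for the stationary process started from `ψ`. -/
noncomputable def meanS (p q : ℝ) (L : ℕ) (t : ℕ) (x : Fin L) : ℝ :=
  ∑ r0 : Fin L → Bool, ∑ r1 : Fin L → Bool, ∑ r2 : Fin L → Bool,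
    ∑' k : Fin L → ℕ,
      psi p q r0 * ((Wmat p q L) ^ (t - 1)) r0 r1 * Kker p q r1 r2 k * (k x : ℝ)

/-- `E[s(x,t) s(x',t+τ)]` (`t, τ ≥ 1`) for the stationary process started from `ψ`. -/
noncomputable def corrS (p q : ℝ) (L : ℕ) (t τ : ℕ) (x x' : Fin L) : ℝ :=
  ∑ r0 : Fin L → Bool, ∑ r1 : Fin L → Bool, ∑ r2 : Fin L → Bool,
    ∑ r3 : Fin L → Bool, ∑ r4 : Fin L → Bool,
      ∑' k1 : Fin L → ℕ, ∑' k2 : Fin L → ℕ,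
        psi p q r0 * ((Wmat p q L) ^ (t - 1)) r0 r1 *
          Kker p q r1 r2 k1 * (k1 x : ℝ) *
          ((Wmat p q L) ^ (τ - 1)) r2 r3 *
          Kker p q r3 r4 k2 * (k2 x' : ℝ)

/-! ### The leftmost rule and termination -/

theorem minRule_eq_none {s : State L} : minRule s = none ↔ s.w = 0 := by
  unfold minRule; split_ifs with h <;> simp [h]

theorem minRule_mem {s : State L} {x : Fin L} (h : minRule s = some x) : x ∈ s.w := by
  unfold minRule at h
  split_ifs at h with h0
  rw [Option.some.injEq] at h
  rw [← h]
  exact Multiset.mem_toFinset.mp (Finset.min'_mem _ _)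

theorem minRule_le {s : State L} {x : Fin L} (h : minRule s = some x) {y : Fin L}
    (hy : y ∈ s.w) : x ≤ y := by
  unfold minRule at h
  split_ifs at h with h0
  rw [Option.some.injEq] at h
  rw [← h]
  exact Finset.min'_le _ _ (Multiset.mem_toFinset.mpr hy)

theorem minRule_eq_some {s : State L} {x : Fin L} (hx : x ∈ s.w) (h : ∀ y ∈ s.w, x ≤ y) :
    minRule s = some x := by
  cases hm : minRule s with
  | none => rw [minRule_eq_none.mp hm] at hx; simp at hx
  | some y => rw [le_antisymm (minRule_le hm hx) (h y (minRule_mem hm))]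

theorem mem_succSite {x y : Fin L} : y ∈ succSite L x ↔ y.val = x.val + 1 := by
  unfold succSite
  split_ifs with h
  · simp [Fin.ext_iff]
  · simp; omega

theorem sum_update_add {M : Type*} [AddCommMonoid M] (S : Finset (Fin L)) (φ : Fin L → Bool → M)
    (z : Fin L → Bool) (x : Fin L) (b : Bool) :
    (∑ u ∈ S, φ u (Function.update z x b u)) + (if x ∈ S then φ x (z x) else 0)
      = (∑ u ∈ S, φ u (z u)) + (if x ∈ S then φ x b else 0) := by
  by_cases hx : x ∈ S
  · have h : ∑ u ∈ S.erase x, φ u (Function.update z x b u) = ∑ u ∈ S.erase x, φ u (z u) :=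
      Finset.sum_congr rfl fun u hu => by
        rw [Function.update_of_ne (Finset.ne_of_mem_erase hu)]
    rw [← Finset.add_sum_erase S _ hx, ← Finset.add_sum_erase S (fun u => φ u (z u)) hx, h]
    simp only [hx, if_true, Function.update_self]
    abel
  · simp only [hx, if_false, add_zero]
    exact Finset.sum_congr rfl fun u hu => by
      rw [Function.update_of_ne (fun h : u = x => hx (h ▸ hu))]

theorem potential_update (z : Fin L → Bool) (w : Multiset (Fin L)) (x : Fin L) (b : Bool) :
    potential ⟨Function.update z x b, w⟩ + (if z x then L + 1 - x.val else 0)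
      = potential ⟨z, w⟩ + (if b then L + 1 - x.val else 0) := by
  have h := sum_update_add Finset.univ (fun u c => if c then L + 1 - u.val else 0) z x b
  simp only [Finset.mem_univ, if_true] at h
  unfold potential
  simp only
  omega

theorem potential_add (z : Fin L → Bool) (w w' : Multiset (Fin L)) :
    potential ⟨z, w + w'⟩ = potential ⟨z, w⟩ + (w'.map fun x => L + 1 - x.val).sum := by
  unfold potential
  simp only [Multiset.map_add, Multiset.sum_add]
  omega

theorem potential_erase (z : Fin L → Bool) (w : Multiset (Fin L)) {x : Fin L} (hx : x ∈ w) :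
    potential ⟨z, w.erase x⟩ + (L + 1 - x.val) = potential ⟨z, w⟩ := by
  have h := Multiset.cons_erase hx
  have h2 : (w.map fun x => L + 1 - x.val).sum
      = L + 1 - x.val + ((w.erase x).map fun x => L + 1 - x.val).sum := by
    conv_lhs => rw [← h]
    simp
  unfold potential
  simp only
  omega

theorem sum_succSite_lt (x : Fin L) :
    ((succSite L x).map fun x => L + 1 - x.val).sum < L + 1 - x.val := by
  have := x.isLt
  unfold succSite
  split_ifs with h
  · simp; omega
  · simp

theorem card_succSite_le (x : Fin L) : Multiset.card (succSite L x) ≤ 1 := by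
  unfold succSite; split_ifs <;> simp

theorem fuel_topple_lt {s : State L} {x : Fin L} (hz : s.z x = true) :
    fuel (topple s x) < fuel s := by
  have h1 := potential_update s.z (s.w + succSite L x) x false
  have h2 := potential_add s.z s.w (succSite L x)
  have h3 := sum_succSite_lt x
  have h4 := card_succSite_le x
  simp only [hz, if_true, Bool.false_eq_true, if_false] at h1
  unfold fuel topple
  simp only [Multiset.card_add]
  have h5 : potential s = potential ⟨s.z, s.w⟩ := rfl
  omega

theorem fuel_settle_lt {s : State L} {x : Fin L} (hx : x ∈ s.w) (hz : s.z x = false) :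
    fuel (settle s x) < fuel s := by
  have h1 := potential_update s.z (s.w.erase x) x true
  have h2 := potential_erase s.z s.w hx
  have h4 := Multiset.card_erase_add_one hx
  simp only [hz, if_true, Bool.false_eq_true, if_false] at h1
  unfold fuel settle
  have h5 : potential s = potential ⟨s.z, s.w⟩ := rfl
  simp only
  omega

theorem fuel_jump_lt {s : State L} {x : Fin L} (hx : x ∈ s.w) :
    fuel (jump s x) < fuel s := by
  have h1 := potential_add s.z (s.w.erase x) (succSite L x)
  have h2 := potential_erase s.z s.w hx
  have h3 := sum_succSite_lt x
  have h4 := Multiset.card_erase_add_one hx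
  have h6 := card_succSite_le x
  unfold fuel jump
  have h5 : potential s = potential ⟨s.z, s.w⟩ := rfl
  simp only [Multiset.card_add]
  omega

theorem stabilizeAux_succ (p q : ℝ) (c : Fin L → Bool) (n : ℕ) (s : State L) (h : fuel s ≤ n) :
    stabilizeAux p q minRule (n + 1) s c = stabilizeAux p q minRule n s c := by
  induction n generalizing s with
  | zero =>
    have hw : s.w = 0 := by
      rw [← Multiset.card_eq_zero]
      unfold fuel at h
      omega
    simp [stabilizeAux, minRule_eq_none.mpr hw, hw]
  | succ n ih =>
    rw [stabilizeAux, stabilizeAux]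
    cases hm : minRule s with
    | none => rfl
    | some x =>
      have hx := minRule_mem hm
      cases hz : s.z x with
      | true =>
        have := fuel_topple_lt hz
        simp only [hz, if_true]
        exact ih (topple s x) (by omega)
      | false =>
        have := fuel_settle_lt hx hz
        have := fuel_jump_lt hx
        simp only [hz, Bool.false_eq_true, if_false]
        rw [ih (settle s x) (by omega), ih (jump s x) (by omega)]

theorem stabilizeAux_eq_fuel (p q : ℝ) (c : Fin L → Bool) {n : ℕ} {s : State L}
    (h : fuel s ≤ n) :
    stabilizeAux p q minRule n s c = stabilizeAux p q minRule (fuel s) s c := by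
  induction n, h using Nat.le_induction with
  | base => rfl
  | succ n hn ih => rw [stabilizeAux_succ p q c n s hn, ih]

/-- The expectation of `F` at the stable field reached from `s`. -/
noncomputable def stabExp (p q : ℝ) (s : State L) (F : (Fin L → Bool) → ℝ) : ℝ :=
  ∑ c, stabilizeAux p q minRule (fuel s) s c * F c

theorem stabExp_eq_sum (p q : ℝ) {n : ℕ} {s : State L} (h : fuel s ≤ n)
    (F : (Fin L → Bool) → ℝ) :
    stabExp p q s F = ∑ c, stabilizeAux p q minRule n s c * F c :=
  Finset.sum_congr rfl fun c _ => by rw [stabilizeAux_eq_fuel p q c h]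

theorem stabExp_stable (p q : ℝ) {s : State L} (h : s.w = 0) (F : (Fin L → Bool) → ℝ) :
    stabExp p q s F = F s.z := by
  rw [stabExp_eq_sum p q (Nat.le_succ _)]
  simp [stabilizeAux, minRule_eq_none.mpr h]

theorem stabExp_topple (p q : ℝ) {s : State L} {x : Fin L} (h : minRule s = some x)
    (hz : s.z x = true) (F : (Fin L → Bool) → ℝ) :
    stabExp p q s F = stabExp p q (topple s x) F := by
  rw [stabExp_eq_sum p q (Nat.le_succ (fuel s)),
    stabExp_eq_sum p q (fuel_topple_lt hz).le]
  simp [stabilizeAux, h, hz]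

theorem stabExp_branch (p q : ℝ) {s : State L} {x : Fin L} (h : minRule s = some x)
    (hz : s.z x = false) (F : (Fin L → Bool) → ℝ) :
    stabExp p q s F = p * stabExp p q (settle s x) F + q * stabExp p q (jump s x) F := by
  have hx := minRule_mem h
  rw [stabExp_eq_sum p q (Nat.le_succ (fuel s)),
    stabExp_eq_sum p q (fuel_settle_lt hx hz).le, stabExp_eq_sum p q (fuel_jump_lt hx).le,
    Finset.mul_sum, Finset.mul_sum, ← Finset.sum_add_distrib]
  refine Finset.sum_congr rfl fun c _ => ?_
  simp only [stabilizeAux, h, hz, Bool.false_eq_true, if_false]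
  ring

/-! ### Local observables and single-site averages -/

/-- `F` depends only on the sites of index less than `k`. -/
def IsLocal (k : ℕ) (F : (Fin L → Bool) → ℝ) : Prop :=
  ∀ z z' : Fin L → Bool, (∀ y, y.val < k → z y = z' y) → F z = F z'

theorem IsLocal.mono {k m : ℕ} {F : (Fin L → Bool) → ℝ} (h : IsLocal k F) (hkm : k ≤ m) :
    IsLocal m F :=
  fun z z' hz => h z z' fun y hy => hz y (by omega)

theorem IsLocal.update {k : ℕ} {F : (Fin L → Bool) → ℝ} (h : IsLocal k F) {x : Fin L}
    (hx : k ≤ x.val) (z : Fin L → Bool) (b : Bool) : F (Function.update z x b) = F z :=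
  h _ _ fun y hy => Function.update_of_ne (fun e => by subst e; omega) _ _

/-- Averaging over the Bernoulli(`p`) variable at site `x`. -/
noncomputable def siteAvg (p q : ℝ) (x : Fin L) :
    ((Fin L → Bool) → ℝ) →ₗ[ℝ] ((Fin L → Bool) → ℝ) where
  toFun G z := p * G (Function.update z x true) + q * G (Function.update z x false)
  map_add' G H := by ext z; simp only [Pi.add_apply]; ring
  map_smul' a G := by ext z; simp only [Pi.smul_apply, smul_eq_mul, RingHom.id_apply]; ring

theorem siteAvg_apply (p q : ℝ) (x : Fin L) (G : (Fin L → Bool) → ℝ) (z : Fin L → Bool) :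
    siteAvg p q x G z
      = p * G (Function.update z x true) + q * G (Function.update z x false) := rfl

theorem siteAvg_update (p q : ℝ) (x : Fin L) (G : (Fin L → Bool) → ℝ) (z : Fin L → Bool)
    (b : Bool) : siteAvg p q x G (Function.update z x b) = siteAvg p q x G z := by
  simp [siteAvg_apply]

theorem IsLocal.siteAvg {p q : ℝ} {x : Fin L} {F : (Fin L → Bool) → ℝ}
    (h : IsLocal (x.val + 1) F) : IsLocal x.val (siteAvg p q x F) := by
  intro z z' hz
  have key : ∀ b, F (Function.update z x b) = F (Function.update z' x b) := fun b =>
    h _ _ fun y hy => by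
      by_cases hyx : y = x
      · subst hyx; simp
      · rw [Function.update_of_ne hyx, Function.update_of_ne hyx]
        exact hz y (by have : y.val ≠ x.val := fun e => hyx (Fin.ext e)
                       omega)
  rw [siteAvg_apply, siteAvg_apply, key, key]

theorem siteAvg_mul_of_isLocal (p q : ℝ) {x : Fin L} {k : ℕ} (hk : k ≤ x.val)
    {h : (Fin L → Bool) → ℝ} (hh : IsLocal k h) (G : (Fin L → Bool) → ℝ) :
    siteAvg p q x (h * G) = h * siteAvg p q x G := by
  ext z
  simp only [siteAvg_apply, Pi.mul_apply, hh.update hk]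
  ring

theorem stabExp_of_isLocal {p q : ℝ} (hpq : p + q = 1) {k : ℕ} {F : (Fin L → Bool) → ℝ}
    (hF : IsLocal k F) (s : State L) (hw : ∀ y ∈ s.w, k ≤ y.val) :
    stabExp p q s F = F s.z := by
  induction hn : fuel s using Nat.strong_induction_on generalizing s with
  | _ n ih =>
  subst hn
  cases hm : minRule s with
  | none => exact stabExp_stable p q (minRule_eq_none.mp hm) F
  | some x =>
    have hx := minRule_mem hm
    have hkx := hw x hx
    have hsucc : ∀ y ∈ succSite L x, k ≤ y.val := fun y hy => by
      have := mem_succSite.mp hy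
      omega
    have herase : ∀ y ∈ s.w.erase x, k ≤ y.val := fun y hy => hw y (Multiset.mem_of_mem_erase hy)
    cases hz : s.z x with
    | true =>
      rw [stabExp_topple p q hm hz, ih _ (fuel_topple_lt hz) (topple s x) _ rfl]
      · exact hF.update hkx _ _
      · intro y hy
        exact (Multiset.mem_add.mp hy).elim (hw y) (hsucc y)
    | false =>
      rw [stabExp_branch p q hm hz, ih _ (fuel_settle_lt hx hz) (settle s x) herase rfl,
        ih _ (fuel_jump_lt hx) (jump s x)
          (fun y hy => (Multiset.mem_add.mp hy).elim (herase y) (hsucc y)) rfl]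
      have : F (settle s x).z = F s.z := hF.update hkx _ _
      rw [this, show (jump s x).z = s.z from rfl, ← add_mul, hpq, one_mul]

/-- A site that receives a particle ends up in the Bernoulli state, whatever the number of
particles it receives. -/
theorem stabExp_eq_siteAvg {p q : ℝ} (hpq : p + q = 1) {x : Fin L} {F : (Fin L → Bool) → ℝ}
    (hF : IsLocal (x.val + 1) F) (s : State L) (hx : x ∈ s.w) (hw : ∀ y ∈ s.w, x ≤ y) :
    stabExp p q s F = siteAvg p q x F s.z := by
  induction hn : fuel s using Nat.strong_induction_on generalizing s with
  | _ n ih =>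
  subst hn
  have hm := minRule_eq_some hx hw
  have hsucc : ∀ y ∈ succSite L x, x < y := fun y hy => by
    have := mem_succSite.mp hy
    exact Fin.lt_def.mpr (by omega)
  have herase : ∀ y ∈ s.w.erase x, x ≤ y := fun y hy => hw y (Multiset.mem_of_mem_erase hy)
  cases hz : s.z x with
  | true =>
    rw [stabExp_topple p q hm hz, ih _ (fuel_topple_lt hz) (topple s x) _ _ rfl]
    · exact siteAvg_update ..
    · exact Multiset.mem_add.mpr (Or.inl hx)
    · intro y hy
      exact (Multiset.mem_add.mp hy).elim (hw y) (fun h => (hsucc y h).le)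
  | false =>
    rw [stabExp_branch p q hm hz]
    by_cases hx2 : x ∈ s.w.erase x
    · rw [ih _ (fuel_settle_lt hx hz) (settle s x) hx2 herase rfl,
        ih _ (fuel_jump_lt hx) (jump s x) (Multiset.mem_add.mpr (Or.inl hx2))
          (fun y hy => (Multiset.mem_add.mp hy).elim (herase y) (fun h => (hsucc y h).le)) rfl]
      have : siteAvg p q x F (settle s x).z = siteAvg p q x F s.z := siteAvg_update ..
      rw [this, show (jump s x).z = s.z from rfl, ← add_mul, hpq, one_mul]
    · have herase' : ∀ y ∈ s.w.erase x, x.val + 1 ≤ y.val := fun y hy =>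
        Fin.lt_def.mp (lt_of_le_of_ne (herase y hy) (fun e => hx2 (e ▸ hy)))
      rw [stabExp_of_isLocal hpq hF (settle s x) herase',
        stabExp_of_isLocal hpq hF (jump s x) (fun y hy =>
          (Multiset.mem_add.mp hy).elim (herase' y) (fun h => Fin.lt_def.mp (hsucc y h))),
        siteAvg_apply]
      have : Function.update s.z x false = s.z := by rw [← hz, Function.update_eq_self]
      rw [this]
      rfl

theorem siteAvg_stabExp {p q : ℝ} (hpq : p + q = 1) {x : Fin L} {F : (Fin L → Bool) → ℝ}
    (hF : IsLocal (x.val + 1) F) (w : Multiset (Fin L)) (z : Fin L → Bool) :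
    siteAvg p q x (fun z => stabExp p q ⟨z, w⟩ F) z
      = stabExp p q ⟨z, w⟩ (siteAvg p q x F) := by
  induction hn : fuel ⟨Function.update z x true, w⟩ using Nat.strong_induction_on
    generalizing z w with
  | _ n ih =>
  subst hn
  by_cases hw : ∀ y ∈ w, x ≤ y
  · by_cases hx : x ∈ w
    · have h1 : (fun z => stabExp p q ⟨z, w⟩ F) = siteAvg p q x F :=
        funext fun z => stabExp_eq_siteAvg hpq hF ⟨z, w⟩ hx hw
      rw [h1, stabExp_eq_siteAvg hpq (hF.siteAvg.mono (Nat.le_succ _)) ⟨z, w⟩ hx hw]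
    · have h1 : (fun z => stabExp p q ⟨z, w⟩ F) = F :=
        funext fun z => stabExp_of_isLocal hpq hF ⟨z, w⟩ fun y hy =>
          Fin.lt_def.mp (lt_of_le_of_ne (hw y hy) (fun e => hx (e ▸ hy)))
      rw [h1, stabExp_of_isLocal hpq hF.siteAvg ⟨z, w⟩ fun y hy => Fin.le_def.mp (hw y hy)]
  · push Not at hw
    obtain ⟨u, huw, hux⟩ := hw
    obtain ⟨y, hy⟩ : ∃ y, minRule (⟨z, w⟩ : State L) = some y := by
      cases hm : minRule (⟨z, w⟩ : State L) with
      | none => rw [show w = 0 from minRule_eq_none.mp hm] at huw; simp at huw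
      | some y => exact ⟨y, rfl⟩
    have hyw : y ∈ w := minRule_mem hy
    have hyx : y ≠ x := (lt_of_le_of_lt (minRule_le hy huw) hux).ne
    have hm : ∀ z', minRule (⟨z', w⟩ : State L) = some y := fun _ => hy
    have hzb : ∀ b, Function.update z x b y = z y := fun b => Function.update_of_ne hyx _ _
    cases hz : z y with
    | true =>
      have hstep := ih _ (fuel_topple_lt (s := ⟨Function.update z x true, w⟩) ((hzb _).trans hz))
        (w + succSite L y) (Function.update z y false)
        (by rw [Function.update_comm hyx]; rfl)
      rw [stabExp_topple p q (hm z) hz]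
      simp only [siteAvg_apply] at hstep ⊢
      rw [stabExp_topple p q (hm _) ((hzb true).trans hz),
        stabExp_topple p q (hm _) ((hzb false).trans hz)]
      simp only [topple]
      rw [← Function.update_comm hyx, ← Function.update_comm hyx]
      exact hstep
    | false =>
      have hstep1 := ih _ (fuel_settle_lt (s := ⟨Function.update z x true, w⟩) hyw
        ((hzb _).trans hz)) (w.erase y) (Function.update z y true)
        (by rw [Function.update_comm hyx]; rfl)
      have hstep2 := ih _ (fuel_jump_lt (s := ⟨Function.update z x true, w⟩) hyw)
        (w.erase y + succSite L y) z rfl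
      rw [stabExp_branch p q (hm z) hz]
      simp only [siteAvg_apply] at hstep1 hstep2 ⊢
      rw [stabExp_branch p q (hm _) ((hzb true).trans hz),
        stabExp_branch p q (hm _) ((hzb false).trans hz)]
      simp only [settle, jump]
      rw [← hstep1, ← hstep2, Function.update_comm hyx, Function.update_comm hyx]
      ring

theorem sum_eq_half_sum_update (f : (Fin L → Bool) → ℝ) (x : Fin L) :
    2 * ∑ r, f r = ∑ r, (f (Function.update r x true) + f (Function.update r x false)) := by
  have hinv : Function.Involutive fun r : Fin L → Bool => Function.update r x (!r x) := by
    intro r; simp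
  have h := Equiv.sum_comp hinv.toPerm f
  rw [two_mul]
  nth_rewrite 1 [← h]
  rw [← Finset.sum_add_distrib]
  refine Finset.sum_congr rfl fun r _ => ?_
  have hr := Function.update_eq_self x r
  cases hrx : r x <;> rw [hrx] at hr <;> simp [Function.Involutive.toPerm, hrx, hr, add_comm]

theorem psi_eq_prod (p q : ℝ) (r : Fin L → Bool) :
    psi p q r = ∏ x, if r x then p else q := by
  rw [Finset.prod_ite, Finset.prod_const, Finset.prod_const]
  unfold psi
  congr 2
  rw [← Finset.compl_filter, Finset.card_compl, Fintype.card_fin]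

theorem psi_update (p q : ℝ) (r : Fin L → Bool) (x : Fin L) (b : Bool) :
    psi p q (Function.update r x b)
      = (if b then p else q) * ∏ y ∈ Finset.univ.erase x, if r y then p else q := by
  rw [psi_eq_prod, ← Finset.mul_prod_erase _ _ (Finset.mem_univ x), Function.update_self]
  congr 1
  exact Finset.prod_congr rfl fun y hy => by
    rw [Function.update_of_ne (Finset.ne_of_mem_erase hy)]

theorem sum_psi_mul_siteAvg {p q : ℝ} (hpq : p + q = 1) (x : Fin L) (G : (Fin L → Bool) → ℝ) :
    ∑ r, psi p q r * siteAvg p q x G r = ∑ r, psi p q r * G r := by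
  have h1 := sum_eq_half_sum_update (fun r => psi p q r * siteAvg p q x G r) x
  have h2 := sum_eq_half_sum_update (fun r => psi p q r * G r) x
  suffices 2 * ∑ r, psi p q r * siteAvg p q x G r = 2 * ∑ r, psi p q r * G r by linarith
  rw [h1, h2]
  refine Finset.sum_congr rfl fun r _ => ?_
  simp only [siteAvg_update, psi_update, if_true, Bool.false_eq_true, if_false]
  rw [← add_mul, ← add_mul, hpq, siteAvg_apply]
  ring

/-! ### Averaging over all sites to the right of a given one -/

/-- The occupation number of site `y`. -/
def occ (y : Fin L) (z : Fin L → Bool) : ℝ := ((z y).toNat : ℝ)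

theorem isLocal_occ {y : Fin L} {k : ℕ} (h : y.val < k) : IsLocal k (occ y) :=
  fun z z' hz => by simp [occ, hz y h]

/-- `T` averages over the Bernoulli(`p`) variables at the sites of index at least `k`, and
commutes with stabilization. -/
structure IsTailAvg (p q : ℝ) (k : ℕ)
    (T : ((Fin L → Bool) → ℝ) →ₗ[ℝ] ((Fin L → Bool) → ℝ)) : Prop where
  stabExp : ∀ w G z, T (fun z => stabExp p q ⟨z, w⟩ G) z = DSS.stabExp p q ⟨z, w⟩ (T G)
  isLocal : ∀ G, IsLocal k (T G)
  mul : ∀ h G, IsLocal k h → T (h * G) = h * T G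
  one : T 1 = 1
  occ : ∀ y : Fin L, k ≤ y.val → T (occ y) = fun _ => p
  psi : ∀ G, ∑ r, psi p q r * T G r = ∑ r, DSS.psi p q r * G r

theorem exists_isTailAvg {p q : ℝ} (hpq : p + q = 1) {k : ℕ} (hk : k ≤ L) :
    ∃ T : ((Fin L → Bool) → ℝ) →ₗ[ℝ] ((Fin L → Bool) → ℝ), IsTailAvg p q k T := by
  induction hk using Nat.decreasingInduction with
  | self =>
    refine ⟨LinearMap.id, fun _ _ _ => rfl, fun G z z' h => ?_, fun _ _ _ => rfl, rfl,
      fun y hy => absurd y.isLt (by omega), fun _ => rfl⟩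
    rw [show z = z' from funext fun y => h y y.isLt]
  | of_succ k hk ih =>
    obtain ⟨T, hT⟩ := ih
    let x : Fin L := ⟨k, hk⟩
    refine ⟨(siteAvg p q x).comp T, ?_, ?_, ?_, ?_, ?_, ?_⟩
    · intro w G z
      have h1 : T (fun z => DSS.stabExp p q ⟨z, w⟩ G) = fun z => DSS.stabExp p q ⟨z, w⟩ (T G) :=
        funext (hT.stabExp w G)
      rw [LinearMap.comp_apply, h1]
      exact siteAvg_stabExp hpq (x := x) (hT.isLocal G) w z
    · exact fun G => IsLocal.siteAvg (x := x) (hT.isLocal G)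
    · intro h G hh
      rw [LinearMap.comp_apply, hT.mul h G (hh.mono (Nat.le_succ k)),
        siteAvg_mul_of_isLocal p q (x := x) le_rfl hh]
      rfl
    · ext z
      simp [hT.one, siteAvg_apply, hpq]
    · intro y hy
      ext z
      rcases eq_or_lt_of_le hy with e | hlt
      · have hyx : y = x := Fin.ext e.symm
        have h1 : T (DSS.occ y) = DSS.occ y := by
          have := hT.mul (DSS.occ y) 1 (isLocal_occ (by omega))
          rwa [hT.one, mul_one] at this
        rw [LinearMap.comp_apply, h1, siteAvg_apply, hyx]
        simp [DSS.occ]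
      · rw [LinearMap.comp_apply, hT.occ y hlt, siteAvg_apply, ← add_mul, hpq, one_mul]
    · intro G
      rw [← hT.psi G]
      exact sum_psi_mul_siteAvg hpq x (T G)

open Matrix in
theorem IsTailAvg.mulVec {p q : ℝ} {k : ℕ}
    {T : ((Fin L → Bool) → ℝ) →ₗ[ℝ] ((Fin L → Bool) → ℝ)} (hT : IsTailAvg p q k T)
    (G : (Fin L → Bool) → ℝ) : T (Wmat p q L *ᵥ G) = Wmat p q L *ᵥ T G :=
  funext fun z => hT.stabExp _ G z

open Matrix in
theorem IsTailAvg.pow_mulVec {p q : ℝ} {k : ℕ}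
    {T : ((Fin L → Bool) → ℝ) →ₗ[ℝ] ((Fin L → Bool) → ℝ)} (hT : IsTailAvg p q k T)
    (n : ℕ) (G : (Fin L → Bool) → ℝ) :
    T (Wmat p q L ^ n *ᵥ G) = Wmat p q L ^ n *ᵥ T G := by
  induction n generalizing G with
  | zero => simp
  | succ n ih => rw [pow_succ, ← mulVec_mulVec, ih, hT.mulVec, mulVec_mulVec]

/-! ### Particle conservation -/

/-- The number of stable particles at the sites up to `y`. -/
def stableCount (y : Fin L) (z : Fin L → Bool) : ℕ := ∑ u ∈ Finset.Iic y, (z u).toNat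

/-- The number of particles at the sites up to `y`. -/
def particleCount (y : Fin L) (s : State L) : ℕ :=
  s.w.countP (· ≤ y) + stableCount y s.z

theorem stableCount_update (y : Fin L) (z : Fin L → Bool) (x : Fin L) (b : Bool) :
    stableCount y (Function.update z x b) + (if x ≤ y then (z x).toNat else 0)
      = stableCount y z + (if x ≤ y then b.toNat else 0) := by
  simpa only [stableCount, Finset.mem_Iic] using
    sum_update_add (Finset.Iic y) (fun _ c => c.toNat) z x b

theorem countP_succSite (x y : Fin L) :
    (succSite L x).countP (· ≤ y) + (if y = x then 1 else 0) = if x ≤ y then 1 else 0 := by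
  have := x.isLt
  have := y.isLt
  by_cases h : x.val + 1 < L
  · simp only [succSite, h, dite_true, ← Multiset.cons_zero, Multiset.countP_cons,
      Multiset.countP_zero, Fin.ext_iff, Fin.le_def]
    split_ifs <;> omega
  · simp only [succSite, h, dite_false, Multiset.countP_zero, Fin.ext_iff, Fin.le_def]
    split_ifs <;> omega

theorem countP_erase (w : Multiset (Fin L)) {x : Fin L} (hx : x ∈ w) (y : Fin L) :
    (w.erase x).countP (· ≤ y) + (if x ≤ y then 1 else 0) = w.countP (· ≤ y) := by
  conv_rhs => rw [← Multiset.cons_erase hx, Multiset.countP_cons]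

theorem particleCount_topple {s : State L} {x : Fin L} (hz : s.z x = true) (y : Fin L) :
    particleCount y (topple s x) + (if y = x then 1 else 0) = particleCount y s := by
  have h1 := stableCount_update y s.z x false
  have h2 := countP_succSite x y
  rw [hz] at h1
  simp only [Bool.toNat_true, Bool.toNat_false, ite_self] at h1
  unfold particleCount topple
  simp only [Multiset.countP_add]
  omega

theorem particleCount_settle {s : State L} {x : Fin L} (hx : x ∈ s.w) (hz : s.z x = false)
    (y : Fin L) : particleCount y (settle s x) = particleCount y s := by
  have h1 := stableCount_update y s.z x true
  have h2 := countP_erase s.w hx y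
  rw [hz] at h1
  simp only [Bool.toNat_true, Bool.toNat_false, ite_self] at h1
  unfold particleCount settle
  simp only
  omega

theorem particleCount_jump {s : State L} {x : Fin L} (hx : x ∈ s.w) (y : Fin L) :
    particleCount y (jump s x) + (if y = x then 1 else 0) = particleCount y s := by
  have h1 := countP_succSite x y
  have h2 := countP_erase s.w hx y
  unfold particleCount jump
  simp only [Multiset.countP_add]
  omega

theorem stabilizeAux_eq_zero (p q : ℝ) {c : Fin L → Bool} {y : Fin L} (n : ℕ) (s : State L)
    (h : particleCount y s < stableCount y c) : stabilizeAux p q minRule n s c = 0 := by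
  have hzc : s.z ≠ c := by
    rintro rfl
    unfold particleCount at h
    omega
  induction n generalizing s with
  | zero => simp [stabilizeAux, hzc]
  | succ n ih =>
    have ih' : ∀ s, particleCount y s < stableCount y c →
        stabilizeAux p q minRule n s c = 0 := fun s h => ih s h (by
      rintro rfl
      unfold particleCount at h
      omega)
    rw [stabilizeAux]
    cases hm : minRule s with
    | none => simp [hzc]
    | some x =>
      have hx := minRule_mem hm
      cases hz : s.z x with
      | true =>
        have := particleCount_topple hz y
        simpa [hz] using ih' (topple s x) (by omega)
      | false =>
        have h1 := particleCount_settle hx hz y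
        have h2 := particleCount_jump hx y
        simp [hz, ih' (settle s x) (by omega), ih' (jump s x) (by omega)]

/-- The topplings are determined by the initial state and the final stable field. -/
theorem stabilizeSAux_eq_ite (p q : ℝ) (c : Fin L → Bool) (n : ℕ) (s : State L)
    (k : Fin L → ℕ) :
    stabilizeSAux p q minRule n s c k
      = if ∀ y, k y + stableCount y c = particleCount y s
        then stabilizeAux p q minRule n s c else 0 := by
  have step : ∀ (n : ℕ) (s s' : State L) (x : Fin L) (k : Fin L → ℕ),
      (∀ y, particleCount y s' + (if y = x then 1 else 0) = particleCount y s) →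
      (∀ k, stabilizeSAux p q minRule n s' c k
        = if ∀ y, k y + stableCount y c = particleCount y s'
          then stabilizeAux p q minRule n s' c else 0) →
      (if k x = 0 then 0 else stabilizeSAux p q minRule n s' c (Function.update k x (k x - 1)))
        = if ∀ y, k y + stableCount y c = particleCount y s
          then stabilizeAux p q minRule n s' c else 0 := by
    intro n s s' x k hs ih
    by_cases hk : k x = 0
    · rw [if_pos hk]
      split_ifs with hall
      · have h1 := hs x
        have h2 := hall x
        rw [if_pos rfl] at h1
        exact (stabilizeAux_eq_zero p q (y := x) n s' (by omega)).symm
      · rfl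
    · rw [if_neg hk, ih]
      refine if_congr (forall_congr' fun y => ?_) rfl rfl
      have h1 := hs y
      by_cases hy : y = x
      · subst hy
        rw [if_pos rfl] at h1
        rw [Function.update_self]
        omega
      · rw [if_neg hy] at h1
        rw [Function.update_of_ne hy]
        omega
  induction n generalizing s k with
  | zero =>
    rw [stabilizeSAux, stabilizeAux]
    by_cases hw : s.w = 0 <;> by_cases hz : s.z = c <;> simp [hw, hz]
    simp [particleCount, hw, hz, funext_iff]
  | succ n ih =>
    rw [stabilizeSAux, stabilizeAux]
    cases hm : minRule s with
    | none =>
      by_cases hz : s.z = c <;> simp [hz]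
      simp [particleCount, minRule_eq_none.mp hm, hz, funext_iff]
    | some x =>
      have hx := minRule_mem hm
      cases hz : s.z x with
      | true =>
        simp only [hz, if_true]
        exact step n s _ x k (particleCount_topple hz) (fun k => ih _ k)
      | false =>
        simp only [hz, Bool.false_eq_true, if_false]
        rw [step n s _ x k (particleCount_jump hx) (fun k => ih _ k), ih]
        simp only [particleCount_settle hx hz]
        split_ifs <;> simp

theorem particleCount_addGrain (r : Fin L → Bool) (y : Fin L) :
    particleCount y (addGrain r) = 1 + stableCount y r := by
  have hL : 0 < L := y.pos
  unfold particleCount addGrain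
  simp only [hL, dite_true, ← Multiset.cons_zero, Multiset.countP_cons, Multiset.countP_zero,
    Fin.le_def]
  simp

/-- The number of topplings at `x` in an avalanche from `r` to `r'`. -/
noncomputable def toppleCount (x : Fin L) (r r' : Fin L → Bool) : ℝ :=
  1 + (stableCount x r : ℝ) - stableCount x r'

theorem exists_Kker_eq (p q : ℝ) (r r' : Fin L → Bool) :
    ∃ k₀ : Fin L → ℕ, (∀ k, k ≠ k₀ → Kker p q r r' k = 0) ∧
      ∀ x, Kker p q r r' k₀ * (k₀ x : ℝ) = Wmat p q L r r' * toppleCount x r r' := by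
  have hK : ∀ k, Kker p q r r' k
      = if ∀ y, k y + stableCount y r' = 1 + stableCount y r then Wmat p q L r r' else 0 := by
    intro k
    rw [Kker, stabilizeSAux_eq_ite]
    simp only [particleCount_addGrain]
    rfl
  refine ⟨fun y => 1 + stableCount y r - stableCount y r', fun k hk => ?_, fun x => ?_⟩
  · rw [hK, if_neg]
    intro h
    exact hk (funext fun y => by have := h y; omega)
  · rw [hK]
    split_ifs with h
    · unfold toppleCount
      rw [Nat.cast_sub (by have := h x; omega)]
      push_cast
      rfl
    · push Not at h
      obtain ⟨y, hy⟩ := h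
      have : Wmat p q L r r' = 0 := stabilizeAux_eq_zero p q (y := y) _ _ (by
        rw [particleCount_addGrain]
        omega)
      rw [this, zero_mul, zero_mul]

/-! ### Correlations in operator form -/

open Matrix

/-- The transition operator weighted by the number of topplings at `x`. -/
noncomputable def toppleOp (p q : ℝ) (x : Fin L) (F : (Fin L → Bool) → ℝ) :
    (Fin L → Bool) → ℝ :=
  fun r => ∑ r', Wmat p q L r r' * toppleCount x r r' * F r'

theorem corrS_eq_sum (p q : ℝ) (t τ : ℕ) (x x' : Fin L) :
    corrS p q L t τ x x' = ∑ r, psi p q r *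
      (Wmat p q L ^ (t - 1) *ᵥ toppleOp p q x (Wmat p q L ^ (τ - 1) *ᵥ toppleOp p q x' 1)) r := by
  simp only [corrS, mulVec, dotProduct, toppleOp, Finset.mul_sum, Pi.one_apply, mul_one]
  refine Finset.sum_congr rfl fun r0 _ => Finset.sum_congr rfl fun r1 _ =>
    Finset.sum_congr rfl fun r2 _ => Finset.sum_congr rfl fun r3 _ =>
    Finset.sum_congr rfl fun r4 _ => ?_
  obtain ⟨k1, h1, h1'⟩ := exists_Kker_eq p q r1 r2
  obtain ⟨k2, h2, h2'⟩ := exists_Kker_eq p q r3 r4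
  rw [tsum_eq_single k1 (fun k hk => by simp [h1 k hk]),
    tsum_eq_single k2 (fun k hk => by simp [h2 k hk])]
  rw [← h1', ← h2']
  ring

theorem stableCount_cast (x : Fin L) (z : Fin L → Bool) :
    (stableCount x z : ℝ) = ∑ u ∈ Finset.Iic x, occ u z := by
  simp [stableCount, occ]

theorem isLocal_stableCount (x : Fin L) :
    IsLocal (x.val + 1) (fun z => (stableCount x z : ℝ)) := by
  intro z z' h
  simp only [stableCount_cast]
  exact Finset.sum_congr rfl fun u hu =>
    isLocal_occ (Nat.lt_succ_of_le (Fin.le_def.mp (Finset.mem_Iic.mp hu))) z z' h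

theorem toppleOp_eq (p q : ℝ) (x : Fin L) (F : (Fin L → Bool) → ℝ) :
    toppleOp p q x F = (fun z => 1 + (stableCount x z : ℝ)) * (Wmat p q L *ᵥ F)
      - Wmat p q L *ᵥ ((fun z => (stableCount x z : ℝ)) * F) := by
  ext r
  simp only [toppleOp, toppleCount, Pi.sub_apply, Pi.mul_apply, mulVec, dotProduct,
    Finset.mul_sum, ← Finset.sum_sub_distrib]
  exact Finset.sum_congr rfl fun r' _ => by ring

/-- The number of stable particles between `l` (excluded) and `x` (included). -/
noncomputable def excess (l x : Fin L) : (Fin L → Bool) → ℝ := ∑ y ∈ Finset.Ioc l x, occ y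

theorem toppleOp_eq_add (p q : ℝ) {l x : Fin L} (h : l ≤ x) (F : (Fin L → Bool) → ℝ) :
    toppleOp p q x F = toppleOp p q l F
      + (excess l x * (Wmat p q L *ᵥ F) - Wmat p q L *ᵥ (excess l x * F)) := by
  have hx : (fun z => (stableCount x z : ℝ)) = (fun z => (stableCount l z : ℝ)) + excess l x := by
    ext z
    have hd : Disjoint (Finset.Iic l) (Finset.Ioc l x) :=
      Finset.disjoint_left.mpr fun u hu hu' =>
        (Finset.mem_Ioc.mp hu').1.not_ge (Finset.mem_Iic.mp hu)
    have hu : Finset.Iic x = Finset.Iic l ∪ Finset.Ioc l x := by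
      ext u
      simp only [Finset.mem_Iic, Finset.mem_union, Finset.mem_Ioc]
      constructor
      · intro hu
        rcases le_or_gt u l with h' | h'
        · exact Or.inl h'
        · exact Or.inr ⟨h', hu⟩
      · rintro (h' | h')
        · exact h'.trans h
        · exact h'.2
    simp only [Pi.add_apply, stableCount_cast, excess, Finset.sum_apply]
    rw [hu, Finset.sum_union hd]
  have hx1 : (fun z => 1 + (stableCount x z : ℝ))
      = (fun z => 1 + (stableCount l z : ℝ)) + excess l x := by
    ext z
    have := congrFun hx z
    simp only [Pi.add_apply] at this ⊢
    linarith
  rw [toppleOp_eq, toppleOp_eq, hx, hx1, add_mul, add_mul, mulVec_add]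
  abel

namespace IsTailAvg

variable {p q : ℝ} {l : Fin L} {T : ((Fin L → Bool) → ℝ) →ₗ[ℝ] ((Fin L → Bool) → ℝ)}

theorem toppleOp (hT : IsTailAvg p q (l.val + 1) T) (F : (Fin L → Bool) → ℝ) :
    T (toppleOp p q l F) = DSS.toppleOp p q l (T F) := by
  have hl := isLocal_stableCount l
  rw [toppleOp_eq, toppleOp_eq, map_sub, hT.mulVec, hT.mul _ _ hl, hT.mul, hT.mulVec]
  intro z z' h
  have := hl z z' h
  simp only at this ⊢
  rw [this]

theorem excess_mul (hT : IsTailAvg p q (l.val + 1) T) (x : Fin L) {F : (Fin L → Bool) → ℝ}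
    (hF : T F = F) : T (excess l x * F) = ((Finset.Ioc l x).card * p : ℝ) • F := by
  have hloc : IsLocal (l.val + 1) F := hF ▸ hT.isLocal F
  rw [mul_comm, hT.mul _ _ hloc, excess, map_sum,
    Finset.sum_congr rfl fun y hy => hT.occ y (Finset.mem_Ioc.mp hy).1]
  ext z
  simp
  ring

theorem commutator (hT : IsTailAvg p q (l.val + 1) T) (x : Fin L) {F : (Fin L → Bool) → ℝ}
    (hF : T F = F) :
    T (excess l x * (Wmat p q L *ᵥ F) - Wmat p q L *ᵥ (excess l x * F)) = 0 := by
  rw [map_sub, hT.mulVec, hT.excess_mul x hF, hT.excess_mul x (by rw [hT.mulVec, hF]),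
    mulVec_smul, sub_self]

end IsTailAvg

/-- min property of the avalanche correlations. In the stationary process,
for all sites `x, x'`, `t ≥ 1` and `τ ≥ 1`,
`E[s(x,t) s(x',t+τ)] = E[s(l,t) s(l,t+τ)]` where `l = min(x,x')`. -/
theorem avalanche_correlation_min_property
    (L : ℕ) (hL : 0 < L) (p q : ℝ) (hp : 0 < p) (hq : 0 < q) (hpq : p + q = 1)
    (x x' : Fin L) (t τ : ℕ) (ht : 1 ≤ t) (hτ : 1 ≤ τ) :
    corrS p q L t τ x x' = corrS p q L t τ (min x x') (min x x') := by
  set l := min x x' with hl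
  obtain ⟨T, hT⟩ := exists_isTailAvg (L := L) hpq (Nat.succ_le_of_lt l.isLt)
  have reduce : ∀ F G : (Fin L → Bool) → ℝ, T F = T G →
      ∑ r, psi p q r * (Wmat p q L ^ (t - 1) *ᵥ F) r
        = ∑ r, psi p q r * (Wmat p q L ^ (t - 1) *ᵥ G) r := fun F G h => by
    rw [← hT.psi, ← hT.psi (Wmat p q L ^ (t - 1) *ᵥ G), hT.pow_mulVec, hT.pow_mulVec, h]
  rw [corrS_eq_sum, corrS_eq_sum]
  apply reduce
  rcases le_total x x' with h | h
  · have hlx : l = x := min_eq_left h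
    rw [← hlx, hT.toppleOp, hT.toppleOp, hT.pow_mulVec, hT.pow_mulVec,
      toppleOp_eq_add p q (hlx.trans_le h), map_add, hT.commutator x' hT.one, add_zero]
  · have hlx : l = x' := min_eq_right h
    rw [← hlx, toppleOp_eq_add p q (hlx.trans_le h), map_add, hT.commutator x, add_zero]
    rw [hT.pow_mulVec, hT.toppleOp, hT.one]

end DSS
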